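/- If T_n is a uniformly random labeled binary tree of size n ≥ 2, then the labeled binary tree obtained from T_n by best-of-three erasure is a uniformly random labeled binary tree of size n−1. -/

import Mathlib

/-- A plane binary tree whose non-root leaves carry natural-number labels.
The root leaf (always labeled 0) is left implicit: an `LTree` is the part of
the tree above the unique edge incident to the root. -/
inductive LTree where
  | leaf : ℕ → LTree
  | node : LTree → LTree → LTree
deriving DecidableEq

namespace LTree

/-- The size: number of branching (degree-3) nodes. -/
def size : LTree → ℕ
  | leaf _ => 0
  | node l r => size l + size r + 1

/-- The list of labels of the (non-root) leaves, left to right. -/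
def labs : LTree → List ℕ
  | leaf a => [a]
  | node l r => labs l ++ labs r

/-- `t` is a labeled binary tree of size `n`: it has `n` branching nodes and its
`n+1` non-root leaves are bijectively labeled by `{1,…,n+1}` (the root leaf gets 0). -/
def IsLab (n : ℕ) (t : LTree) : Prop :=
  size t = n ∧ List.Perm (labs t) ((List.range (n + 1)).map (· + 1))

/-- Number of elements of `L` strictly smaller than `x`. -/
def rank (L : List ℕ) (x : ℕ) : ℕ := L.countP (fun y => decide (y < x))

/-- Best-of-three comparison at a branching node with children `l`, `r`:
`true` iff at least two of the three minimally-labeled leaves of the fringe set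
lie in the left child `l`. -/
def goLeft (l r : LTree) : Bool :=
  decide (2 ≤ (labs l).countP (fun x => decide (rank (labs l ++ labs r) x < 3)))

/-- The branching node selected by the best-of-three procedure (returned as the
fringe subtree rooted at it). -/
def botSel : LTree → LTree
  | leaf a => leaf a
  | node (leaf a) (leaf b) => node (leaf a) (leaf b)
  | node l r => if goLeft l r then botSel l else botSel r

/-- The number of moves performed by the best-of-three selection. -/
def botDepth : LTree → ℕ
  | leaf _ => 0
  | node (leaf _) (leaf _) => 0
  | node l r => (if goLeft l r then botDepth l else botDepth r) + 1

/-- The position (sequence of left/right moves, `false` = left) of the selected node. -/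
def botPos : LTree → List Bool
  | leaf _ => []
  | node (leaf _) (leaf _) => []
  | node l r => if goLeft l r then false :: botPos l else true :: botPos r

/-- Cut at the selected node: the two sibling leaves above it are removed, the
node becomes a leaf carrying the smaller label; returns the cut tree together
with the erased (BoT) label, i.e. the larger of the two. -/
def botCut : LTree → LTree × ℕ
  | leaf a => (leaf a, 0)
  | node (leaf a) (leaf b) => (leaf (min a b), max a b)
  | node l r =>
    if goLeft l r then (node (botCut l).1 r, (botCut l).2)
    else (node l (botCut r).1, (botCut r).2)

/-- Relabel increasingly after erasing label `j`. -/
def relabel (j : ℕ) : LTree → LTree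
  | leaf a => leaf (if a < j then a else a - 1)
  | node l r => node (relabel j l) (relabel j r)

/-- The label of the Best-of-Three leaf. -/
def botLabel (t : LTree) : ℕ := (botCut t).2

/-- Best-of-three erasure, including the increasing relabeling. -/
def botErase (t : LTree) : LTree := relabel (botCut t).2 (botCut t).1

/-- Positions (in the original coordinates of `t`) of the branching nodes cut by
`k` successive best-of-three erasures, in order of erasure. -/
def eraseList : ℕ → LTree → List (List Bool)
  | 0, _ => []
  | k + 1, t => botPos t :: eraseList k (botErase t)

/-- The fringe subtree at a position (`false` = left child, `true` = right child). -/
def subAt : LTree → List Bool → Option LTree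
  | t, [] => some t
  | leaf _, _ :: _ => none
  | node l _, false :: p => subAt l p
  | node _ r, true :: p => subAt r p

/-- Shift labels `≥ j` up by one, freeing the label `j`. -/
def relabelUp (j : ℕ) : LTree → LTree
  | leaf a => leaf (if a < j then a else a + 1)
  | node l r => node (relabelUp j l) (relabelUp j r)

/-- Graft a new leaf labeled `j` to the left (`side = false`) or right
(`side = true`) of the leaf labeled `w`. -/
def graft (w j : ℕ) (side : Bool) : LTree → LTree
  | leaf a =>
    if a = w then (if side then node (leaf a) (leaf j) else node (leaf j) (leaf a))
    else leaf a
  | node l r => node (graft w j side l) (graft w j side r)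

/-- The binary tree obtained from the `ℓ`-span (the unary–binary subtree spanned by
the root and the leaves labeled `1,…,ℓ`) by contracting its degree-2 vertices. -/
def trim (ℓ : ℕ) : LTree → LTree
  | leaf a => leaf a
  | node l r =>
    if (labs l).all (fun x => decide (ℓ < x)) then trim ℓ r
    else if (labs r).all (fun x => decide (ℓ < x)) then trim ℓ l
    else node (trim ℓ l) (trim ℓ r)

/-- Map a position in `trim ℓ t` back to the corresponding position in `t`. -/
def trimPos (ℓ : ℕ) : LTree → List Bool → List Bool
  | leaf _, p => p
  | node l r, p =>
    if (labs l).all (fun x => decide (ℓ < x)) then true :: trimPos ℓ r p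
    else if (labs r).all (fun x => decide (ℓ < x)) then false :: trimPos ℓ l p
    else
      match p with
      | [] => []
      | true :: q => true :: trimPos ℓ r q
      | false :: q => false :: trimPos ℓ l q

end LTree

namespace LTree

lemma length_labs (t : LTree) : (labs t).length = size t + 1 := by
  induction t with
  | leaf a => rfl
  | node l r hl hr => simp only [labs, size, List.length_append, hl, hr]; omega

lemma rank_congr {L M : List ℕ} (h : L.Perm M) (x : ℕ) : rank L x = rank M x :=
  h.countP_eq _

lemma rank_append (L M : List ℕ) (x : ℕ) : rank (L ++ M) x = rank L x + rank M x :=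
  List.countP_append

lemma rank_cons (j : ℕ) (L : List ℕ) (x : ℕ) :
    rank (j :: L) x = rank L x + if j < x then 1 else 0 := by
  simp [rank, List.countP_cons]

lemma rank_mono (L : List ℕ) {x y : ℕ} (h : x ≤ y) : rank L x ≤ rank L y :=
  List.countP_mono_left fun z _ hz => by
    simp only [decide_eq_true_eq] at hz ⊢
    omega

/-- Among the elements of a duplicate-free list, exactly the `k` smallest have rank below `k`. -/
lemma countP_rank_lt {K : List ℕ} (hK : K.Nodup) (k : ℕ) :
    K.countP (fun x => decide (rank K x < k)) = min k K.length := by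
  have sorted_case : ∀ (K : List ℕ), K.Pairwise (· < ·) → ∀ k,
      K.countP (fun x => decide (rank K x < k)) = min k K.length := by
    intro K
    induction K with
    | nil => simp
    | cons a K ih =>
      intro h k
      rw [List.pairwise_cons] at h
      have h0 : rank K a = 0 := by
        simp only [rank, List.countP_eq_zero, decide_eq_true_eq, not_lt]
        exact fun x hx => (h.1 x hx).le
      rw [List.countP_cons]
      cases k with
      | zero => simp
      | succ k =>
        have h1 : K.countP (fun x => decide (rank (a :: K) x < k + 1)) =
            K.countP (fun x => decide (rank K x < k)) := by
          refine List.countP_congr fun x hx => ?_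
          simp [rank_cons, h.1 x hx]
        rw [h1, ih h.2 k]
        simp only [rank_cons, h0, lt_irrefl, if_false, List.length_cons]
        simp
  have hp : (K.mergeSort (· ≤ ·)).Perm K := List.mergeSort_perm K _
  have hs : (K.mergeSort (· ≤ ·)).Pairwise (· < ·) := by
    have h1 := List.pairwise_mergeSort' (· ≤ ·) K
    have h2 : (K.mergeSort (· ≤ ·)).Pairwise (· ≠ ·) := hp.nodup_iff.2 hK
    exact (h1.and h2).imp fun h => lt_of_le_of_ne h.1 h.2
  have h := sorted_case _ hs k
  rw [hp.countP_eq, hp.length_eq] at h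
  simpa only [rank_congr hp] using h

/-- The trees whose cut at the selected node produces the tree `s` and the erased label `j`. -/
def cutPreimages (j : ℕ) : LTree → List LTree
  | leaf a => if a < j then [node (leaf a) (leaf j), node (leaf j) (leaf a)] else []
  | node l r =>
    ((cutPreimages j l).filter (fun t => goLeft t r)).map (fun t => node t r) ++
    ((cutPreimages j r).filter (fun t => !goLeft l t)).map (fun t => node l t)

lemma perm_labs_of_mem_cutPreimages {j : ℕ} {s t : LTree} (h : t ∈ cutPreimages j s) :
    (labs t).Perm (j :: labs s) := by
  induction s generalizing t with
  | leaf a =>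
    simp only [cutPreimages] at h
    split_ifs at h
    · simp only [List.mem_cons, List.not_mem_nil, or_false] at h
      rcases h with rfl | rfl
      · exact List.Perm.swap _ _ _
      · exact List.Perm.refl _
    · simp at h
  | node l r hl hr =>
    simp only [cutPreimages, List.mem_append, List.mem_map, List.mem_filter] at h
    rcases h with ⟨u, ⟨hu, -⟩, rfl⟩ | ⟨u, ⟨hu, -⟩, rfl⟩
    · exact (hl hu).append_right _
    · exact ((hr hu).append_left _).trans List.perm_middle

lemma size_of_mem_cutPreimages {j : ℕ} {s t : LTree} (h : t ∈ cutPreimages j s) :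
    size t = size s + 1 := by
  have h1 := (perm_labs_of_mem_cutPreimages h).length_eq
  simp only [List.length_cons, length_labs] at h1
  omega

lemma nodup_cutPreimages (j : ℕ) (s : LTree) : (cutPreimages j s).Nodup := by
  induction s with
  | leaf a =>
    simp only [cutPreimages]
    split_ifs with h
    · simp [h.ne]
    · simp
  | node l r hl hr =>
    simp only [cutPreimages]
    refine List.Nodup.append ((hl.filter _).map fun _ _ h => (node.inj h).1)
      ((hr.filter _).map fun _ _ h => (node.inj h).2) ?_
    intro t h1 h2
    simp only [List.mem_map, List.mem_filter] at h1 h2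
    obtain ⟨u, ⟨hu, -⟩, rfl⟩ := h1
    obtain ⟨v, -, hv⟩ := h2
    have h3 := size_of_mem_cutPreimages hu
    rw [(node.inj hv).1] at h3
    omega

lemma goLeft_leaf_left (a : ℕ) (r : LTree) : goLeft (leaf a) r = false := by
  simp only [goLeft, decide_eq_false_iff_not, not_le]
  exact lt_of_le_of_lt List.countP_le_length (by simp [labs])

lemma goLeft_leaf_right {l : LTree} {b : ℕ} (hl : 1 ≤ size l)
    (hd : (labs (node l (leaf b))).Nodup) : goLeft l (leaf b) = true := by
  have h : (labs l ++ labs (leaf b)).countP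
      (fun x => decide (rank (labs l ++ labs (leaf b)) x < 3)) =
      min 3 (labs l ++ labs (leaf b)).length := countP_rank_lt hd 3
  have h1 := length_labs l
  have h2 : (labs (leaf b)).countP
      (fun x => decide (rank (labs l ++ labs (leaf b)) x < 3)) ≤ 1 :=
    List.countP_le_length
  have h3 : (labs (leaf b)).length = 1 := rfl
  rw [List.countP_append, List.length_append] at h
  rw [goLeft, decide_eq_true_eq]
  omega

lemma botCut_node {l r : LTree} (h : 1 ≤ size l ∨ 1 ≤ size r) :
    botCut (node l r) = if goLeft l r then (node (botCut l).1 r, (botCut l).2)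
      else (node l (botCut r).1, (botCut r).2) := by
  cases l with
  | node => rfl
  | leaf a =>
    cases r with
    | node => rfl
    | leaf b => simp [size] at h

lemma botCut_of_mem_cutPreimages {j : ℕ} {s t : LTree} (h : t ∈ cutPreimages j s) :
    botCut t = (s, j) := by
  induction s generalizing t with
  | leaf a =>
    simp only [cutPreimages] at h
    split_ifs at h with haj
    · simp only [List.mem_cons, List.not_mem_nil, or_false] at h
      rcases h with rfl | rfl <;> simp [botCut, haj.le]
    · simp at h
  | node l r hl hr =>
    simp only [cutPreimages, List.mem_append, List.mem_map, List.mem_filter] at h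
    rcases h with ⟨u, ⟨hu, hg⟩, rfl⟩ | ⟨u, ⟨hu, hg⟩, rfl⟩
    · rw [botCut_node (Or.inl (by rw [size_of_mem_cutPreimages hu]; omega)), if_pos hg, hl hu]
    · rw [botCut_node (Or.inr (by rw [size_of_mem_cutPreimages hu]; omega)),
        if_neg (by simpa using hg), hr hu]

lemma mem_cutPreimages_botCut {t : LTree} (ht : 1 ≤ size t) (hd : (labs t).Nodup) :
    t ∈ cutPreimages (botCut t).2 (botCut t).1 := by
  induction t with
  | leaf a => simp [size] at ht
  | node l r hl hr =>
    have hd' := hd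
    simp only [labs] at hd'
    by_cases h : 1 ≤ size l ∨ 1 ≤ size r
    · rw [botCut_node h]
      by_cases hg : goLeft l r = true
      · have h1 : 1 ≤ size l := by
          cases l with
          | leaf a => simp [goLeft_leaf_left] at hg
          | node => simp [size]
        simp only [hg, if_true, cutPreimages, List.mem_append]
        left
        exact List.mem_map.2 ⟨l, List.mem_filter.2 ⟨hl h1 hd'.of_append_left, hg⟩, rfl⟩
      · have h1 : 1 ≤ size r := by
          cases r with
          | leaf b =>
            exact absurd (goLeft_leaf_right (h.resolve_right (by simp [size])) hd) hg
          | node => simp [size]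
        rw [if_neg hg]
        simp only [cutPreimages, List.mem_append]
        right
        exact List.mem_map.2
          ⟨r, List.mem_filter.2 ⟨hr h1 hd'.of_append_right, by simpa using hg⟩, rfl⟩
    · cases l with
      | node => simp [size] at h
      | leaf a =>
        cases r with
        | node => simp [size] at h
        | leaf b =>
          have hab : a ≠ b := by simpa [labs] using hd
          rcases lt_or_gt_of_ne hab with h1 | h1
          · simp [botCut, cutPreimages, h1, h1.le]
          · simp [botCut, cutPreimages, h1, h1.le]

/-- Inserting `j` on either side of a split list `L ++ R` creates, over both sides, as many
best-of-three choices as the truncated number of elements below `j`. -/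
lemma bestOfThree_split {L R : List ℕ} {j : ℕ} (hd : (j :: (L ++ R)).Nodup) :
    (if 2 ≤ (j :: L).countP (fun x => decide (rank (j :: (L ++ R)) x < 3))
      then min 2 (rank L j) else 0) +
    (if 2 ≤ L.countP (fun x => decide (rank (j :: (L ++ R)) x < 3))
      then 0 else min 2 (rank R j)) = min 2 (rank (L ++ R) j) := by
  have htot := countP_rank_lt hd 3
  have hj : rank (j :: (L ++ R)) j = rank (L ++ R) j := by simp [rank_cons]
  have happ := rank_append L R j
  have below_le : ∀ x, x < j → rank (j :: (L ++ R)) x < rank (L ++ R) j ∨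
      x ∉ L ++ R := by
    intro x hx
    by_cases hm : x ∈ L ++ R
    · left
      have h1 : rank (L ++ R) x < rank (L ++ R) (x + 1) := by
        obtain ⟨A, B, hAB⟩ := List.append_of_mem hm
        rw [hAB]
        simp only [rank_append, rank_cons]
        have hA := rank_mono A (Nat.le_succ x)
        have hB := rank_mono B (Nat.le_succ x)
        simp only [Nat.succ_eq_add_one] at hA hB
        simp
        omega
      have h2 := rank_mono (L ++ R) (show x + 1 ≤ j by omega)
      simp only [rank_cons, if_neg (show ¬ j < x by omega)]
      omega
    · exact Or.inr hm
  rw [List.countP_cons, List.countP_append, List.length_cons, List.length_append] at htot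
  rw [List.countP_cons]
  simp only [hj, decide_eq_true_eq] at htot ⊢
  have hlenL : rank L j ≤ L.length := List.countP_le_length
  have hlenR : rank R j ≤ R.length := List.countP_le_length
  rcases Nat.lt_or_ge (rank (L ++ R) j) 3 with hc | hc
  · have hL : rank L j ≤ L.countP (fun x => decide (rank (j :: (L ++ R)) x < 3)) := by
      refine List.countP_mono_left fun x hx hxj => ?_
      simp only [decide_eq_true_eq] at hxj ⊢
      have := (below_le x hxj).resolve_right (by simp [hx])
      omega
    have hR : rank R j ≤ R.countP (fun x => decide (rank (j :: (L ++ R)) x < 3)) := by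
      refine List.countP_mono_left fun x hx hxj => ?_
      simp only [decide_eq_true_eq] at hxj ⊢
      have := (below_le x hxj).resolve_right (by simp [hx])
      omega
    simp only [hc, if_true] at htot ⊢
    split_ifs <;> omega
  · have hlt : ∀ x, rank (j :: (L ++ R)) x < 3 → x < j := by
      intro x hx
      by_contra hxj
      have := rank_mono (j :: (L ++ R)) (not_lt.1 hxj)
      omega
    have hL : L.countP (fun x => decide (rank (j :: (L ++ R)) x < 3)) ≤ rank L j := by
      refine List.countP_mono_left fun x _ hx => ?_
      simp only [decide_eq_true_eq] at hx ⊢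
      exact hlt x hx
    have hR : R.countP (fun x => decide (rank (j :: (L ++ R)) x < 3)) ≤ rank R j := by
      refine List.countP_mono_left fun x _ hx => ?_
      simp only [decide_eq_true_eq] at hx ⊢
      exact hlt x hx
    simp only [not_lt.2 hc, if_false] at htot ⊢
    split_ifs <;> omega

lemma length_cutPreimages {j : ℕ} {s : LTree} (hd : (j :: labs s).Nodup) :
    (cutPreimages j s).length = 2 * min 2 (rank (labs s) j) := by
  induction s with
  | leaf a =>
    by_cases h : a < j <;> simp [cutPreimages, labs, rank, h]
  | node l r hl hr =>
    have key := bestOfThree_split (L := labs l) (R := labs r) hd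
    simp only [labs] at hd ⊢
    have hdl : (j :: labs l).Nodup :=
      hd.sublist ((List.sublist_append_left _ _).cons_cons j)
    have hdr : (j :: labs r).Nodup :=
      hd.sublist ((List.sublist_append_right _ _).cons_cons j)
    have gl : ∀ t ∈ cutPreimages j l, goLeft t r =
        decide (2 ≤ (j :: labs l).countP
          (fun x => decide (rank (j :: (labs l ++ labs r)) x < 3))) := fun t ht => by
      have hp := perm_labs_of_mem_cutPreimages ht
      simp only [goLeft, hp.countP_eq, rank_congr (hp.append_right (labs r)), List.cons_append]
    have gr : ∀ t ∈ cutPreimages j r, goLeft l t =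
        decide (2 ≤ (labs l).countP
          (fun x => decide (rank (j :: (labs l ++ labs r)) x < 3))) := fun t ht => by
      have hp := ((perm_labs_of_mem_cutPreimages ht).append_left (labs l)).trans
        List.perm_middle
      simp only [goLeft, rank_congr hp]
    simp only [cutPreimages, List.length_append, List.length_map]
    rw [List.filter_congr gl, List.filter_congr fun t ht => congrArg (!·) (gr t ht), ← key, mul_add]
    have hl := hl hdl
    have hr := hr hdr
    clear key gl gr
    split_ifs with h1 h2 h2 <;> simp only [h1, h2] <;> simp [hl, hr]

lemma labs_relabelUp (j : ℕ) (t : LTree) :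
    labs (relabelUp j t) = (labs t).map (fun a => if a < j then a else a + 1) := by
  induction t with
  | leaf a => rfl
  | node l r hl hr => simp [relabelUp, labs, hl, hr]

lemma labs_relabel (j : ℕ) (t : LTree) :
    labs (relabel j t) = (labs t).map (fun a => if a < j then a else a - 1) := by
  induction t with
  | leaf a => rfl
  | node l r hl hr => simp [relabel, labs, hl, hr]

lemma relabel_relabelUp (j : ℕ) (t : LTree) : relabel j (relabelUp j t) = t := by
  induction t with
  | leaf a =>
    simp only [relabel, relabelUp, leaf.injEq]
    split_ifs <;> omega
  | node l r hl hr => simp [relabel, relabelUp, hl, hr]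

lemma relabelUp_relabel {j : ℕ} {t : LTree} (h : j ∉ labs t) :
    relabelUp j (relabel j t) = t := by
  induction t with
  | leaf a =>
    simp only [labs, List.mem_singleton] at h
    simp only [relabel, relabelUp, leaf.injEq]
    split_ifs <;> omega
  | node l r hl hr =>
    simp only [labs, List.mem_append, not_or] at h
    simp [relabel, relabelUp, hl h.1, hr h.2]

/-- Freeing the label `j` in `{1,…,m}` and adding it back yields `{1,…,m+1}`. -/
lemma cons_map_relabelUp_perm {m j : ℕ} (h1 : 1 ≤ j) (h2 : j ≤ m + 1) :
    (j :: ((List.range m).map (· + 1)).map (fun a => if a < j then a else a + 1)).Perm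
      ((List.range (m + 1)).map (· + 1)) := by
  rw [List.perm_ext_iff_of_nodup]
  · intro a
    simp only [List.mem_cons, List.mem_map, List.mem_range]
    constructor
    · rintro (rfl | ⟨_, ⟨b, hb, rfl⟩, rfl⟩)
      · exact ⟨a - 1, by omega, by omega⟩
      · split_ifs
        · exact ⟨b, by omega, rfl⟩
        · exact ⟨b + 1, by omega, rfl⟩
    · rintro ⟨b, hb, rfl⟩
      rcases lt_trichotomy (b + 1) j with h | h | h
      · exact Or.inr ⟨b + 1, ⟨b, by omega, rfl⟩, by simp [h]⟩
      · exact Or.inl h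
      · refine Or.inr ⟨b, ⟨b - 1, by omega, by omega⟩, ?_⟩
        rw [if_neg (by omega)]
  · rw [List.nodup_cons]
    constructor
    · simp only [List.mem_map, not_exists, not_and]
      intro a _
      split_ifs <;> omega
    · refine (List.nodup_range.map fun a b h => ?_).map fun a b h => ?_
      · simpa using h
      · split_ifs at h <;> omega
  · refine List.nodup_range.map fun a b h => ?_
    simpa using h

lemma IsLab.nodup {n : ℕ} {t : LTree} (h : IsLab n t) : (labs t).Nodup := by
  refine h.2.nodup_iff.2 (List.nodup_range.map fun a b h => ?_)
  simpa using h

lemma isLab_of_perm {n : ℕ} {t : LTree}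
    (h : (labs t).Perm ((List.range (n + 1)).map (· + 1))) : IsLab n t := by
  refine ⟨?_, h⟩
  have := h.length_eq
  simp only [length_labs, List.length_map, List.length_range] at this
  omega

lemma IsLab.perm_cons_botCut {m : ℕ} {t : LTree} (h : IsLab (m + 1) t) :
    ((botCut t).2 :: labs (botCut t).1).Perm ((List.range (m + 2)).map (· + 1)) :=
  (perm_labs_of_mem_cutPreimages
    (mem_cutPreimages_botCut (by rw [h.1]; omega) h.nodup)).symm.trans h.2

lemma IsLab.botCut_snd_mem {m : ℕ} {t : LTree} (h : IsLab (m + 1) t) :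
    (botCut t).2 ∈ Finset.Icc 1 (m + 2) := by
  have h1 := h.perm_cons_botCut.mem_iff.1 (List.mem_cons_self)
  simp only [List.mem_map, List.mem_range] at h1
  obtain ⟨b, hb, hb'⟩ := h1
  rw [Finset.mem_Icc]
  omega

lemma IsLab.botErase {m : ℕ} {t : LTree} (h : IsLab (m + 1) t) : IsLab m (botErase t) := by
  apply isLab_of_perm
  have hj := Finset.mem_Icc.1 h.botCut_snd_mem
  have h1 := (h.perm_cons_botCut.trans (cons_map_relabelUp_perm hj.1 hj.2).symm).cons_inv
  rw [LTree.botErase, labs_relabel]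
  refine (h1.map _).trans (List.Perm.of_eq ?_)
  conv_rhs => rw [← List.map_id ((List.range (m + 1)).map (· + 1))]
  rw [List.map_map]
  refine List.map_congr_left fun a _ => ?_
  simp only [Function.comp_apply, id_eq]
  split_ifs <;> omega

lemma IsLab.perm_cons_relabelUp {m j : ℕ} {s : LTree} (hs : IsLab m s)
    (hj : j ∈ Finset.Icc 1 (m + 2)) :
    (j :: labs (relabelUp j s)).Perm ((List.range (m + 2)).map (· + 1)) := by
  rw [Finset.mem_Icc] at hj
  rw [labs_relabelUp]
  exact ((hs.2.map _).cons j).trans (cons_map_relabelUp_perm hj.1 hj.2)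

lemma mem_cutPreimages_relabelUp_iff {m j : ℕ} {s t : LTree} (hs : IsLab m s)
    (hj : j ∈ Finset.Icc 1 (m + 2)) :
    t ∈ cutPreimages j (relabelUp j s) ↔
      IsLab (m + 1) t ∧ LTree.botErase t = s ∧ (botCut t).2 = j := by
  constructor
  · intro h
    have hc := botCut_of_mem_cutPreimages h
    refine ⟨isLab_of_perm ((perm_labs_of_mem_cutPreimages h).trans (hs.perm_cons_relabelUp hj)),
      ?_, by rw [hc]⟩
    rw [LTree.botErase, hc, relabel_relabelUp]
  · rintro ⟨ht, rfl, rfl⟩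
    have hd : ((botCut t).2 :: labs (botCut t).1).Nodup :=
      (ht.perm_cons_botCut.trans ht.2.symm).nodup_iff.2 ht.nodup
    rw [LTree.botErase, relabelUp_relabel (List.nodup_cons.1 hd).1]
    exact mem_cutPreimages_botCut (by rw [ht.1]; omega) ht.nodup

/-- All fibers of best-of-three erasure have the same cardinality. -/
lemma card_filter_botErase {m : ℕ} {A : Finset LTree} (hA : ∀ t, t ∈ A ↔ IsLab (m + 1) t)
    {s : LTree} (hs : IsLab m s) :
    (A.filter (fun t => LTree.botErase t = s)).card =
      ∑ j ∈ Finset.Icc 1 (m + 2), 2 * min 2 (rank (((List.range (m + 1)).map (· + 1)).map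
        (fun a => if a < j then a else a + 1)) j) := by
  rw [Finset.card_eq_sum_card_fiberwise (f := fun t => (botCut t).2)
    (t := Finset.Icc 1 (m + 2))]
  · refine Finset.sum_congr rfl fun j hj => ?_
    have hd : (j :: labs (relabelUp j s)).Nodup :=
      (hs.perm_cons_relabelUp hj).nodup_iff.2
        (List.nodup_range.map fun a b h => by simpa using h)
    have h1 : (A.filter (fun t => LTree.botErase t = s)).filter (fun t => (botCut t).2 = j) =
        (cutPreimages j (relabelUp j s)).toFinset := by
      ext t
      rw [List.mem_toFinset, mem_cutPreimages_relabelUp_iff hs hj, Finset.mem_filter,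
        Finset.mem_filter, hA, and_assoc]
    rw [h1, List.toFinset_card_of_nodup (nodup_cutPreimages _ _), length_cutPreimages hd,
      labs_relabelUp, rank_congr (hs.2.map _)]
  · intro t ht
    simp only [Finset.coe_filter, Set.mem_ofPred_eq, hA] at ht
    exact ht.1.botCut_snd_mem

end LTree

/-- A map between finite sets with fibers of constant cardinality preserves uniformity. -/
lemma PMF.map_uniformOfFinset_of_card_fiber {α β : Type*} [DecidableEq β] {f : α → β}
    {A : Finset α} {B : Finset β} (hA : A.Nonempty) (hB : B.Nonempty)
    (hf : ∀ a ∈ A, f a ∈ B) (k : ℕ) (hk : ∀ b ∈ B, (A.filter (fun a => f a = b)).card = k) :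
    PMF.map f (PMF.uniformOfFinset A hA) = PMF.uniformOfFinset B hB := by
  classical
  have hcard : A.card = B.card * k := by
    rw [Finset.card_eq_sum_card_fiberwise (f := f) (t := B) hf, Finset.sum_congr rfl hk,
      Finset.sum_const, smul_eq_mul]
  have hk0 : k ≠ 0 := by
    rintro rfl
    have := hA.card_pos
    omega
  have hB0 : B.card ≠ 0 := hB.card_pos.ne'
  ext b
  rw [PMF.map_apply, tsum_eq_sum (s := A), PMF.uniformOfFinset_apply]
  · rw [Finset.sum_congr rfl (g := fun a => if f a = b then (A.card : ENNReal)⁻¹ else 0)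
      fun a ha => by simp [PMF.uniformOfFinset_apply, ha, eq_comm],
      ← Finset.sum_filter, Finset.sum_const, nsmul_eq_mul]
    split_ifs with hb
    · rw [hk b hb, hcard, Nat.cast_mul, ENNReal.mul_inv (by simp [hB0]) (by simp),
        mul_left_comm, ENNReal.mul_inv_cancel (by simpa using hk0) (by simp), mul_one]
    · rw [Finset.filter_eq_empty_iff.2 fun a ha (h : f a = b) => hb (h ▸ hf a ha)]
      simp
  · intro a ha
    simp [PMF.uniformOfFinset_apply, ha]

/-- If `T_n` is a uniformly random labeled binary tree of size
`n ≥ 2`, then its best-of-three erasure is a uniformly random labeled binary tree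
of size `n − 1`. -/
theorem botErase_uniform (n : ℕ) (hn : 2 ≤ n) (A B : Finset LTree)
    (hA : ∀ t, t ∈ A ↔ LTree.IsLab n t) (hB : ∀ t, t ∈ B ↔ LTree.IsLab (n - 1) t)
    (hA0 : A.Nonempty) (hB0 : B.Nonempty) :
    PMF.map LTree.botErase (PMF.uniformOfFinset A hA0) =
      PMF.uniformOfFinset B hB0 := by
  obtain ⟨m, rfl⟩ : ∃ m, n = m + 1 := ⟨n - 1, by omega⟩
  rw [Nat.add_sub_cancel] at hB
  exact PMF.map_uniformOfFinset_of_card_fiber hA0 hB0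
    (fun t ht => (hB _).2 ((hA t).1 ht).botErase) _
    fun s hs => LTree.card_filter_botErase hA ((hB s).1 hs)
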